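/- Let p be a prime, K a field, ρ, q ∈ K, and let x, y be natural numbers. Assume [j]_{ρ,q} ≠ 0 for every j with 1 ≤ j ≤ x + y + 1 and p ∤ j. Then the p-adic (ρ,q)-beta function at natural-number arguments satisfies the recurrence β_{ρ,q}(x, y+1) = (δ_{ρ,q}(y) / δ_{ρ,q}(x+y)) · β_{ρ,q}(x, y), and symmetrically β_{ρ,q}(x+1, y) = (δ_{ρ,q}(x) / δ_{ρ,q}(x+y)) · β_{ρ,q}(x, y). -/

import Mathlib

/-- The `(ρ,q)`-number over a field: `[n]_{ρ,q} = Σ_{i=0}^{n−1} ρ^{n−1−i} qⁱ`. -/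
def pqNum {K : Type*} [Field K] (ρ q : K) (n : ℕ) : K :=
  ∑ i ∈ Finset.range n, ρ ^ (n - 1 - i) * q ^ i

/-- The `p`-adic `(ρ,q)`-gamma function at natural-number arguments:
`Γ^p_{ρ,q}(n) = (−1)ⁿ ∏_{1≤j<n, p∤j} [j]_{ρ,q}`. -/
def padicPqGamma {K : Type*} [Field K] (p : ℕ) (ρ q : K) (n : ℕ) : K :=
  (-1) ^ n * ∏ j ∈ (Finset.range n).filter (fun j => ¬ p ∣ j), pqNum ρ q j

/-- `δ_{ρ,q}(n) = −[n]_{ρ,q}` if `p ∤ n` and `δ_{ρ,q}(n) = −1` if `p ∣ n`. -/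
def pqDelta {K : Type*} [Field K] (p : ℕ) (ρ q : K) (n : ℕ) : K :=
  if p ∣ n then -1 else -pqNum ρ q n

/-- The `p`-adic `(ρ,q)`-beta function at natural-number arguments:
`β_{ρ,q}(x, y) = Γ^p_{ρ,q}(x) Γ^p_{ρ,q}(y) / Γ^p_{ρ,q}(x + y)`. -/
noncomputable def padicPqBeta {K : Type*} [Field K] (p : ℕ) (ρ q : K) (x y : ℕ) : K :=
  padicPqGamma p ρ q x * padicPqGamma p ρ q y / padicPqGamma p ρ q (x + y)

theorem padicPqGamma_succ {K : Type*} [Field K] (p : ℕ) (ρ q : K) (n : ℕ) :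
    padicPqGamma p ρ q (n + 1) = pqDelta p ρ q n * padicPqGamma p ρ q n := by
  unfold padicPqGamma pqDelta
  rw [Finset.prod_filter, Finset.prod_filter, Finset.prod_range_succ]
  by_cases hn : p ∣ n <;> simp only [hn, not_true_eq_false, not_false_eq_true, if_true, if_false] <;>
    ring

/-- Recurrences for the `p`-adic `(ρ,q)`-beta function:
`β_{ρ,q}(x, y+1) = (δ_{ρ,q}(y)/δ_{ρ,q}(x+y)) β_{ρ,q}(x, y)` and
`β_{ρ,q}(x+1, y) = (δ_{ρ,q}(x)/δ_{ρ,q}(x+y)) β_{ρ,q}(x, y)`. -/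
theorem padic_pq_beta_recurrence
    (p : ℕ) (hp : p.Prime) (K : Type*) [Field K] (ρ q : K) (x y : ℕ)
    (h : ∀ j : ℕ, 1 ≤ j → j ≤ x + y + 1 → ¬ p ∣ j → pqNum ρ q j ≠ 0) :
    padicPqBeta p ρ q x (y + 1) =
        pqDelta p ρ q y / pqDelta p ρ q (x + y) * padicPqBeta p ρ q x y ∧
      padicPqBeta p ρ q (x + 1) y =
        pqDelta p ρ q x / pqDelta p ρ q (x + y) * padicPqBeta p ρ q x y := by
  unfold padicPqBeta
  rw [← add_assoc, add_right_comm x 1 y]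
  simp only [padicPqGamma_succ]
  exact ⟨by rw [div_mul_div_comm, mul_left_comm], by rw [div_mul_div_comm, mul_assoc]⟩
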